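/- arXiv:2401.02462 — 4 statements merged into one kernel-verified Lean document; each statement's English description precedes it below -/
import Mathlib

section
/- Assume additionally that α is continuously differentiable with bounded derivative, that x ↦ p(x,i) is continuously differentiable on (0,∞) for every i ∈ ℕ, and that G is non-atomic. Let f be a bounded nonnegative Borel function on (0,∞). A bounded nonnegative Borel function (t,x) ↦ u_t(x) on [0,∞) × (0,∞) satisfies, for all t ≥ 0 and x > 0, the equation u_t(x) = f(x−t) + ∫_0^t α(x−s)[1 − g(x−s, ∫_0^∞ e^{−u_{t−s}(y)} G(dy))] ds if and only if it satisfies, for all t ≥ 0 and x > 0, the equation e^{−u_t(x)} = e^{−f(x−t)} + ∫_0^t [g(x−s, ∫_0^∞ e^{−u_{t−s}(y)} G(dy)) − 1] e^{−u_{t−s}(x−s)} α(x−s) ds. -/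
open MeasureTheory Set

/-- Generating function `g(x,z) = Σ_{i≥0} p(x,i) z^i`. -/
noncomputable def gFun (p : ℝ → ℕ → ℝ) (x z : ℝ) : ℝ := ∑' i : ℕ, p x i * z ^ i

/-- `g'(x,1−) = Σ_{i≥1} i·p(x,i)`. -/
noncomputable def gD1 (p : ℝ → ℕ → ℝ) (x : ℝ) : ℝ := ∑' i : ℕ, (i : ℝ) * p x i

open Filter Topology intervalIntegral

/-- Chain rule in integral form: `φ` applied to the primitive `w` of a bounded function `κ`. -/
lemma comp_eq_add_integral_of_eq_add_integral {φ φ' w κ : ℝ → ℝ} {t a M c d : ℝ} (ht : 0 ≤ t)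
    (hκ : IntervalIntegrable κ volume 0 t) (hM : ∀ s ∈ Icc 0 t, |κ s| ≤ M)
    (hφ : ∀ y ∈ Icc c d, HasDerivAt φ (φ' y) y) (hφ' : ContinuousOn φ' (Icc c d))
    (hw : ∀ r ∈ Icc 0 t, w r = a + ∫ s in (0 : ℝ)..r, κ s)
    (hcd : ∀ r ∈ Icc 0 t, w r ∈ Icc c d) :
    φ (w t) = φ a + ∫ s in (0 : ℝ)..t, φ' (w s) * κ s := by
  set W : ℝ → ℝ := fun r => a + ∫ s in (0 : ℝ)..r, κ s with hW
  have h0 : (0 : ℝ) ∈ Icc 0 t := ⟨le_rfl, ht⟩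
  have hint : ∀ r ∈ Icc 0 t, IntervalIntegrable κ volume 0 r := fun r hr =>
    hκ.mono_set (by rw [uIcc_of_le hr.1, uIcc_of_le ht]; exact Icc_subset_Icc le_rfl hr.2)
  have hWmem : MapsTo W (Icc 0 t) (Icc c d) := fun r hr => by
    simpa only [hW, ← hw r hr] using hcd r hr
  have hWlip : LipschitzOnWith M.toNNReal W (Icc 0 t) := by
    refine LipschitzOnWith.of_dist_le_mul fun r hr s hs => ?_
    have hM0 : 0 ≤ M := (abs_nonneg _).trans (hM 0 h0)
    rw [Real.coe_toNNReal M hM0, Real.dist_eq, Real.dist_eq]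
    have : W r - W s = ∫ x in s..r, κ x := by
      rw [← integral_interval_sub_left (hint r hr) (hint s hs)]
      simp only [hW]
      ring
    rw [this]
    refine norm_integral_le_of_norm_le_const (f := κ) fun x hx => hM x ?_
    exact ordConnected_Icc.uIcc_subset hs hr (uIoc_subset_uIcc hx)
  obtain ⟨B, hB⟩ := isCompact_Icc.exists_bound_of_continuousOn hφ'
  have hφlip : LipschitzOnWith B.toNNReal φ (Icc c d) :=
    (convex_Icc c d).lipschitzOnWith_of_nnnorm_hasDerivWithin_le
      (fun x hx => (hφ x hx).hasDerivWithinAt) fun x hx => by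
        rw [← norm_toNNReal]
        exact Real.toNNReal_le_toNNReal (hB x hx)
  have hlip := hφlip.comp hWlip hWmem
  rw [← uIcc_of_le ht] at hlip
  have hftc := hlip.absolutelyContinuousOnInterval.integral_deriv_eq_sub
  have hW0 : W 0 = a := by simp [hW]
  have hcongr : ∫ s in (0 : ℝ)..t, deriv (φ ∘ W) s = ∫ s in (0 : ℝ)..t, φ' (w s) * κ s := by
    refine integral_congr_ae ?_
    filter_upwards [hκ.ae_hasDerivAt_integral] with s hs hst
    have hst' : s ∈ Icc 0 t := by
      rw [← uIcc_of_le ht]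
      exact uIoc_subset_uIcc hst
    have hd : HasDerivAt W (κ s) s := (hs (uIoc_subset_uIcc hst) 0 left_mem_uIcc).const_add a
    rw [((hφ _ (hWmem hst')).comp s hd).deriv, hw s hst']
  rw [hcongr, Function.comp_apply, Function.comp_apply, hW0] at hftc
  rw [hftc, hw t ⟨ht, le_rfl⟩]
  ring

lemma IntervalIntegrable.of_measurable_of_abs_le {κ : ℝ → ℝ} {t M : ℝ} (hκ : Measurable κ)
    (ht : 0 ≤ t) (hM : ∀ s ∈ Icc 0 t, |κ s| ≤ M) : IntervalIntegrable κ volume 0 t := by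
  rw [intervalIntegrable_iff_integrableOn_Icc_of_le ht]
  exact Measure.integrableOn_of_bounded (by simp) hκ.aestronglyMeasurable
    ((ae_restrict_iff' measurableSet_Icc).2 (Eventually.of_forall hM))

/-- A bounded nonnegative `v` is a primitive of `k` if and only if `exp (-v)` is a primitive
of `-k * exp (-v)`. -/
lemma eq_add_integral_iff_exp_neg {v k : ℝ → ℝ} {a C M : ℝ} (hv : Measurable v)
    (hk : Measurable k) (hv0 : ∀ r ≥ 0, 0 ≤ v r) (hvC : ∀ r ≥ 0, v r ≤ C)
    (hM : ∀ r ≥ 0, |k r| ≤ M) :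
    (∀ r ≥ 0, v r = a + ∫ s in (0 : ℝ)..r, k s) ↔
      ∀ r ≥ 0, Real.exp (-v r) =
        Real.exp (-a) + ∫ s in (0 : ℝ)..r, -(k s * Real.exp (-v s)) := by
  constructor
  · intro h r hr
    have := comp_eq_add_integral_of_eq_add_integral (φ := fun y => Real.exp (-y))
      (φ' := fun y => -Real.exp (-y)) (c := 0) (d := C) hr
      (IntervalIntegrable.of_measurable_of_abs_le hk hr fun s hs => hM s hs.1)
      (fun s hs => hM s hs.1)
      (fun y _ => by simpa using (hasDerivAt_neg y).exp) (by fun_prop) (fun s hs => h s hs.1)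
      (fun s hs => ⟨hv0 s hs.1, hvC s hs.1⟩)
    rw [this]
    congr 2
    ext s
    ring
  · intro h r hr
    have hb : ∀ s ∈ Icc 0 r, |-(k s * Real.exp (-v s))| ≤ M := fun s hs => by
      rw [abs_neg, abs_mul, Real.abs_exp]
      have h1 : Real.exp (-v s) ≤ 1 := Real.exp_le_one_iff.2 (by linarith [hv0 s hs.1])
      exact (mul_le_of_le_one_right (abs_nonneg _) h1).trans (hM s hs.1)
    have hpos : ∀ y ∈ Icc (Real.exp (-C)) 1, y ≠ 0 := fun y hy =>
      ((Real.exp_pos _).trans_le hy.1).ne'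
    have := comp_eq_add_integral_of_eq_add_integral (φ := fun y => -Real.log y)
      (φ' := fun y => -y⁻¹) (c := Real.exp (-C)) (d := 1) (w := fun s => Real.exp (-v s)) hr
      (IntervalIntegrable.of_measurable_of_abs_le (by fun_prop) hr hb) hb
      (fun y hy => (Real.hasDerivAt_log (hpos y hy)).neg)
      (continuousOn_id.inv₀ hpos).neg (fun s hs => h s hs.1)
      (fun s hs => ⟨Real.exp_le_exp.2 (by linarith [hvC s hs.1]),
        Real.exp_le_one_iff.2 (by linarith [hv0 s hs.1])⟩)
    simp only [Real.log_exp, neg_neg] at this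
    rw [this]
    congr 2
    ext s
    have := (Real.exp_pos (-v s)).ne'
    field_simp

/-- Rewriting an integral equation on `[0,∞) × (0,∞)` along the characteristics
`r ↦ (r, c + r)`. -/
lemma forall_eq_add_integral_iff_characteristic {A H : ℝ → ℝ → ℝ} {B : ℝ → ℝ}
    (hAB : ∀ t ≥ 0, ∀ x ≤ 0, A t x = B (x - t)) (hH : ∀ t, ∀ x ≤ 0, H t x = 0) :
    (∀ t ≥ 0, ∀ x > 0, A t x = B (x - t) + ∫ s in (0 : ℝ)..t, H (t - s) (x - s)) ↔
      ∀ c, ∀ r ≥ 0, A r (c + r) = B c + ∫ s in (0 : ℝ)..r, H s (c + s) := by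
  have key : ∀ t x, ∫ s in (0 : ℝ)..t, H (t - s) (x - s) =
      ∫ s in (0 : ℝ)..t, H s (x - t + s) := fun t x => by
    have := integral_comp_sub_left (a := 0) (b := t) (fun s => H s (x - t + s)) t
    simpa using this
  constructor
  · intro h c r hr
    rcases lt_or_ge 0 (c + r) with hc | hc
    · rw [h r hr _ hc, key, add_sub_cancel_right]
    · rw [hAB r hr _ hc, add_sub_cancel_right, integral_zero_ae, add_zero]
      refine Eventually.of_forall fun s hs => hH _ _ ?_
      rw [uIoc_of_le hr] at hs
      linarith [hs.2]
  · intro h t ht x _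
    rw [key, ← h (x - t) t ht, sub_add_cancel]

lemma gFun_mem_Icc {p : ℝ → ℕ → ℝ} {x z : ℝ} (hp0 : ∀ i, 0 ≤ p x i) (hp1 : HasSum (p x) 1)
    (hz : z ∈ Icc (0 : ℝ) 1) : gFun p x z ∈ Icc (0 : ℝ) 1 := by
  have h0 : ∀ i, 0 ≤ p x i * z ^ i := fun i => mul_nonneg (hp0 i) (pow_nonneg hz.1 i)
  have hle : ∀ i, p x i * z ^ i ≤ p x i := fun i =>
    mul_le_of_le_one_right (hp0 i) (pow_le_one₀ hz.1 hz.2)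
  have hs := Summable.of_nonneg_of_le h0 hle hp1.summable
  exact ⟨tsum_nonneg h0, hp1.tsum_eq ▸ hs.tsum_le_tsum hle hp1.summable⟩

/-- The generating function cut off outside `(0,∞) × [0,1]` is jointly measurable. -/
lemma measurable_indicator_gFun {p : ℝ → ℕ → ℝ} (hp0 : ∀ x i, 0 ≤ p x i)
    (hp1 : ∀ x > (0 : ℝ), HasSum (p x) 1)
    (hpc : ∀ i : ℕ, ContinuousOn (fun x => p x i) (Ioi 0)) :
    Measurable ((Ioi (0 : ℝ) ×ˢ Icc (0 : ℝ) 1).indicator fun q => gFun p q.1 q.2) := by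
  have hS : MeasurableSet (Ioi (0 : ℝ) ×ˢ Icc (0 : ℝ) 1) :=
    measurableSet_Ioi.prod measurableSet_Icc
  refine measurable_of_tendsto_metrizable (f := fun n => (Ioi (0 : ℝ) ×ˢ Icc (0 : ℝ) 1).indicator
    fun q => ∑ i ∈ Finset.range n, p q.1 i * q.2 ^ i) (fun n => ?_)
    (tendsto_pi_nhds.2 fun q => ?_)
  · have hc : ContinuousOn (fun q : ℝ × ℝ => ∑ i ∈ Finset.range n, p q.1 i * q.2 ^ i)
        (Ioi (0 : ℝ) ×ˢ Icc (0 : ℝ) 1) :=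
      continuousOn_finsetSum _ fun i _ =>
        ((hpc i).comp continuousOn_fst fun q hq => hq.1).mul (continuousOn_snd.pow i)
    classical
    have := hc.measurable_piecewise (continuousOn_const (c := (0 : ℝ))) hS
    rwa [← piecewise_eq_indicator]
  · by_cases hq : q ∈ Ioi (0 : ℝ) ×ˢ Icc (0 : ℝ) 1
    · simp only [indicator_of_mem hq]
      exact (Summable.of_nonneg_of_le (fun i => mul_nonneg (hp0 _ i) (pow_nonneg hq.2.1 i))
        (fun i => mul_le_of_le_one_right (hp0 _ i) (pow_le_one₀ hq.2.1 hq.2.2))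
        (hp1 _ hq.1).summable).hasSum.tendsto_sum_nat
    · simp [indicator_of_notMem hq]

theorem stmt_2
    (α : ℝ → ℝ) (hαm : Measurable α) (hα0 : ∀ x, 0 ≤ α x)
    (hαb : ∃ C, ∀ x, α x ≤ C) (hαz : ∀ x ≤ (0 : ℝ), α x = 0)
    (hαc : ContDiffOn ℝ 1 α (Ioi 0))
    (hαd : ∃ C, ∀ x ∈ Ioi (0 : ℝ), |derivWithin α (Ioi 0) x| ≤ C)
    (p : ℝ → ℕ → ℝ) (hp0 : ∀ x i, 0 ≤ p x i) (hp1 : ∀ x > (0 : ℝ), HasSum (p x) 1)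
    (hpc : ∀ i : ℕ, ContDiffOn ℝ 1 (fun x => p x i) (Ioi 0))
    (hg1s : ∀ x > (0 : ℝ), Summable (fun i : ℕ => (i : ℝ) * p x i))
    (hg1b : ∃ m, ∀ x > (0 : ℝ), gD1 p x ≤ m)
    (G : Measure ℝ) [IsProbabilityMeasure G] (hGz : G (Iic 0) = 0)
    (hGna : ∀ x : ℝ, G {x} = 0)
    (f : ℝ → ℝ) (hfm : Measurable f) (hf0 : ∀ x, 0 ≤ f x)
    (hfb : ∃ C, ∀ x, f x ≤ C) (hfz : ∀ x ≤ (0 : ℝ), f x = 0)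
    (u : ℝ → ℝ → ℝ) (hum : Measurable (Function.uncurry u))
    (hu0 : ∀ t ≥ (0 : ℝ), ∀ x > (0 : ℝ), 0 ≤ u t x)
    (hub : ∃ C, ∀ t ≥ (0 : ℝ), ∀ x > (0 : ℝ), u t x ≤ C)
    (huz : ∀ t, ∀ x ≤ (0 : ℝ), u t x = 0) :
    (∀ t ≥ (0 : ℝ), ∀ x > (0 : ℝ),
      u t x = f (x - t) + ∫ s in (0 : ℝ)..t, α (x - s) *
        (1 - gFun p (x - s) (∫ y in Ioi (0 : ℝ), Real.exp (-(u (t - s) y)) ∂G)))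
    ↔
    (∀ t ≥ (0 : ℝ), ∀ x > (0 : ℝ),
      Real.exp (-(u t x)) = Real.exp (-(f (x - t))) + ∫ s in (0 : ℝ)..t,
        (gFun p (x - s) (∫ y in Ioi (0 : ℝ), Real.exp (-(u (t - s) y)) ∂G) - 1) *
          Real.exp (-(u (t - s) (x - s))) * α (x - s)) := by
  obtain ⟨Cα, hCα⟩ := hαb
  obtain ⟨C, hC⟩ := hub
  set I : ℝ → ℝ := fun τ => ∫ y in Ioi (0 : ℝ), Real.exp (-(u τ y)) ∂G with hI
  have hIm : Measurable I := by
    have : StronglyMeasurable (Function.uncurry fun τ y => Real.exp (-(u τ y))) :=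
      (Real.measurable_exp.comp hum.neg).stronglyMeasurable
    exact this.integral_prod_right.measurable
  have hI01 : ∀ τ ≥ 0, I τ ∈ Icc (0 : ℝ) 1 := fun τ hτ => by
    refine ⟨integral_nonneg fun y => (Real.exp_pos _).le, ?_⟩
    have h1 : I τ ≤ ∫ _ in Ioi (0 : ℝ), (1 : ℝ) ∂G :=
      integral_mono_of_nonneg (Eventually.of_forall fun y => (Real.exp_pos _).le)
        (integrable_const _) ((ae_restrict_iff' measurableSet_Ioi).2 (Eventually.of_forall
          fun y hy => Real.exp_le_one_iff.2 (by linarith [hu0 τ hτ y hy])))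
    refine h1.trans ?_
    rw [setIntegral_const, smul_eq_mul, mul_one]
    exact measureReal_le_one
  -- the cut-off generating function is measurable and agrees with `gFun` where it matters
  set g : ℝ × ℝ → ℝ := (Ioi (0 : ℝ) ×ˢ Icc (0 : ℝ) 1).indicator fun q => gFun p q.1 q.2 with hg
  have hgm : Measurable g := measurable_indicator_gFun hp0 hp1 fun i => (hpc i).continuousOn
  have hg01 : ∀ q, g q ∈ Icc (0 : ℝ) 1 := fun q => by
    by_cases hq : q ∈ Ioi (0 : ℝ) ×ˢ Icc (0 : ℝ) 1
    · rw [hg, indicator_of_mem hq]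
      exact gFun_mem_Icc (hp0 _) (hp1 _ hq.1) hq.2
    · rw [hg, indicator_of_notMem hq]
      exact ⟨le_rfl, zero_le_one⟩
  have hgα : ∀ τ ≥ 0, ∀ x, α x * (1 - gFun p x (I τ)) = α x * (1 - g (x, I τ)) :=
    fun τ hτ x => by
      rcases lt_or_ge 0 x with hx | hx
      · rw [hg, indicator_of_mem (mk_mem_prod (mem_Ioi.2 hx) (hI01 τ hτ))]
      · rw [hαz x hx, zero_mul, zero_mul]
  have hchar₁ := forall_eq_add_integral_iff_characteristic (A := u) (B := f)
    (H := fun τ x => α x * (1 - gFun p x (I τ)))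
    (fun t ht x hx => by rw [huz t x hx, hfz _ (by linarith)])
    (fun t x hx => by simp only [hαz x hx, zero_mul])
  have hchar₂ := forall_eq_add_integral_iff_characteristic
    (A := fun t x => Real.exp (-(u t x))) (B := fun x => Real.exp (-(f x)))
    (H := fun τ x => (gFun p x (I τ) - 1) * Real.exp (-(u τ x)) * α x)
    (fun t ht x hx => by simp only [huz t x hx, hfz (x - t) (by linarith)])
    (fun t x hx => by simp only [hαz x hx, mul_zero])
  refine hchar₁.trans (Iff.trans (forall_congr' fun c => ?_) hchar₂.symm)
  have hmain := eq_add_integral_iff_exp_neg (v := fun r => u r (c + r))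
    (k := fun s => α (c + s) * (1 - g (c + s, I s))) (a := f c) (C := max C 0) (M := Cα)
    (hum.comp (measurable_id.prodMk (measurable_id.const_add c))) (by fun_prop)
    (fun r hr => by
      rcases lt_or_ge 0 (c + r) with hx | hx
      · exact hu0 r hr _ hx
      · exact (huz r _ hx).ge)
    (fun r hr => by
      rcases lt_or_ge 0 (c + r) with hx | hx
      · exact (hC r hr _ hx).trans (le_max_left _ _)
      · exact (huz r _ hx).le.trans (le_max_right _ _))
    (fun r _ => by
      have hq := hg01 (c + r, I r)
      rw [abs_of_nonneg (mul_nonneg (hα0 _) (by linarith [hq.2]))]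
      exact (mul_le_of_le_one_right (hα0 _) (by linarith [hq.1])).trans (hCα _))
  refine Iff.trans (forall₂_congr fun r hr => ?_) (hmain.trans (forall₂_congr fun r hr => ?_))
  · rw [integral_congr fun s hs => ?_]
    rw [uIcc_of_le hr] at hs
    exact hgα s hs.1 _
  · rw [integral_congr fun s hs => ?_]
    rw [uIcc_of_le hr] at hs
    simp only [← hgα s hs.1]
    ring
end

section
/- Let f be a bounded nonnegative Borel function on (0,∞) and let (t,x) ↦ π_t(x) be a locally bounded nonnegative Borel solution of π_t(x) = f(x−t) + ∫_0^t α(x−s) g'(x−s,1−) (∫_0^∞ π_{t−s}(y) G(dy)) ds. Then for every t ≥ 0, sup_{x>0} π_t(x) ≤ ‖f‖ e^{βt}, where ‖f‖ = sup_{x>0} f(x) and β = sup_{x>0} α(x) g'(x,1−). -/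
open MeasureTheory Set

/-- The Picard majorant: its derivative at order `n + 1` is `b` times its value at order `n`. -/
lemma hasDerivAt_exp_add_pow_div_factorial (F C b : ℝ) (n : ℕ) (u : ℝ) :
    HasDerivAt (fun u : ℝ => F * Real.exp (b * u) + C * ((b * u) ^ (n + 1) / (n + 1).factorial))
      (b * (F * Real.exp (b * u) + C * ((b * u) ^ n / n.factorial))) u := by
  have h1 : HasDerivAt (fun u : ℝ => b * u) b u := by
    simpa using (hasDerivAt_id u).const_mul b
  have h := (h1.exp.const_mul F).add
    (((h1.pow (n + 1)).div_const ((n + 1).factorial : ℝ)).const_mul C)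
  refine h.congr_deriv ?_
  have hn : (n.factorial : ℝ) ≠ 0 := by positivity
  simp only [Nat.factorial_succ, Nat.add_sub_cancel]
  push_cast
  field_simp

lemma integral_exp_add_pow_div_factorial (F C b t : ℝ) (n : ℕ) :
    ∫ s in (0 : ℝ)..t, b * (F * Real.exp (b * (t - s)) + C * ((b * (t - s)) ^ n / n.factorial)) =
      F * Real.exp (b * t) + C * ((b * t) ^ (n + 1) / (n + 1).factorial) - F := by
  rw [intervalIntegral.integral_comp_sub_left
    (fun u => b * (F * Real.exp (b * u) + C * ((b * u) ^ n / n.factorial))) t, sub_self, sub_zero,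
    intervalIntegral.integral_eq_sub_of_hasDerivAt
      (fun u _ => hasDerivAt_exp_add_pow_div_factorial F C b n u)
      (Continuous.intervalIntegrable (by fun_prop) _ _)]
  simp

/-- An integral of a function between `0` and `M` against a probability measure is at most `M`,
with no measurability assumption. -/
lemma setIntegral_le_of_forall_le {X : Type*} [MeasurableSpace X] (μ : Measure X)
    [IsProbabilityMeasure μ] {A : Set X} (hA : MeasurableSet A) {h : X → ℝ} {M : ℝ} (hM : 0 ≤ M)
    (h0 : ∀ y ∈ A, 0 ≤ h y) (hle : ∀ y ∈ A, h y ≤ M) : ∫ y in A, h y ∂μ ≤ M := by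
  calc ∫ y in A, h y ∂μ ≤ ∫ _ in A, M ∂μ :=
        integral_mono_of_nonneg (ae_restrict_of_forall_mem hA h0) (integrable_const M)
          (ae_restrict_of_forall_mem hA hle)
    _ = μ.real A * M := by simp
    _ ≤ M := mul_le_of_le_one_left hM measureReal_le_one

theorem stmt_4
    (α : ℝ → ℝ) (hαm : Measurable α) (hα0 : ∀ x, 0 ≤ α x)
    (hαb : ∃ C, ∀ x, α x ≤ C) (hαz : ∀ x ≤ (0 : ℝ), α x = 0)
    (p : ℝ → ℕ → ℝ) (hp0 : ∀ x i, 0 ≤ p x i) (hp1 : ∀ x > (0 : ℝ), HasSum (p x) 1)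
    (hg1s : ∀ x > (0 : ℝ), Summable (fun i : ℕ => (i : ℝ) * p x i))
    (hg1b : ∃ m, ∀ x > (0 : ℝ), gD1 p x ≤ m)
    (G : Measure ℝ) [IsProbabilityMeasure G] (hGz : G (Iic 0) = 0)
    (f : ℝ → ℝ) (hfm : Measurable f) (hf0 : ∀ x, 0 ≤ f x)
    (hfb : ∃ C, ∀ x, f x ≤ C) (hfz : ∀ x ≤ (0 : ℝ), f x = 0)
    (π : ℝ → ℝ → ℝ) (hπm : Measurable (Function.uncurry π))
    (hπ0 : ∀ t ≥ (0 : ℝ), ∀ x > (0 : ℝ), 0 ≤ π t x)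
    (hπb : ∀ T ≥ (0 : ℝ), ∃ C, ∀ t ∈ Icc (0 : ℝ) T, ∀ x > (0 : ℝ), |π t x| ≤ C)
    (hπeq : ∀ t ≥ (0 : ℝ), ∀ x > (0 : ℝ),
      π t x = f (x - t) + ∫ s in (0 : ℝ)..t, α (x - s) * gD1 p (x - s) *
        (∫ y in Ioi (0 : ℝ), π (t - s) y ∂G)) :
    ∀ t ≥ (0 : ℝ), ∀ x > (0 : ℝ),
      π t x ≤ sSup (f '' Ioi 0) *
        Real.exp (sSup ((fun y => α y * gD1 p y) '' Ioi 0) * t) := by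
  set F := sSup (f '' Ioi 0)
  set b := sSup ((fun y => α y * gD1 p y) '' Ioi 0)
  have hg0 : ∀ y, 0 ≤ gD1 p y := fun y =>
    tsum_nonneg fun i => mul_nonneg (Nat.cast_nonneg i) (hp0 y i)
  have hF0 : 0 ≤ F := Real.sSup_nonneg (by rintro _ ⟨y, -, rfl⟩; exact hf0 y)
  have hb0 : 0 ≤ b :=
    Real.sSup_nonneg (by rintro _ ⟨y, -, rfl⟩; exact mul_nonneg (hα0 y) (hg0 y))
  have hfF : ∀ y, f y ≤ F := by
    intro y
    rcases le_or_gt y 0 with hy | hy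
    · rw [hfz y hy]; exact hF0
    · obtain ⟨C, hC⟩ := hfb
      exact le_csSup ⟨C, by rintro _ ⟨z, -, rfl⟩; exact hC z⟩ ⟨y, hy, rfl⟩
  have hαb' : ∀ y, α y * gD1 p y ≤ b := by
    intro y
    rcases le_or_gt y 0 with hy | hy
    · rw [hαz y hy, zero_mul]; exact hb0
    · obtain ⟨C, hC⟩ := hαb
      obtain ⟨m, hm⟩ := hg1b
      refine le_csSup ⟨C * m, ?_⟩ ⟨y, hy, rfl⟩
      rintro _ ⟨z, hz, rfl⟩
      exact mul_le_mul (hC z) (hm z hz) (hg0 z) ((hα0 z).trans (hC z))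
  intro T hT x hx
  obtain ⟨C, hC⟩ := hπb T hT
  have hC0 : 0 ≤ C := (abs_nonneg _).trans (hC T ⟨hT, le_rfl⟩ x hx)
  have key : ∀ n : ℕ, ∀ t ∈ Icc (0 : ℝ) T, ∀ x > (0 : ℝ),
      π t x ≤ F * Real.exp (b * t) + C * ((b * t) ^ n / n.factorial) := by
    intro n
    induction n with
    | zero =>
      intro t ht x hx
      have h1 := (le_abs_self _).trans (hC t ht x hx)
      have h2 : 0 ≤ F * Real.exp (b * t) := by positivity
      simpa using h1.trans (le_add_of_nonneg_left h2)
    | succ n ih =>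
      intro t ht x hx
      have hint : ∫ s in (0 : ℝ)..t, α (x - s) * gD1 p (x - s) *
            (∫ y in Ioi (0 : ℝ), π (t - s) y ∂G) ≤
          ∫ s in (0 : ℝ)..t,
            b * (F * Real.exp (b * (t - s)) + C * ((b * (t - s)) ^ n / n.factorial)) := by
        rw [intervalIntegral.integral_of_le ht.1, intervalIntegral.integral_of_le ht.1]
        have hnn : ∀ s ∈ Ioc 0 t, 0 ≤ ∫ y in Ioi (0 : ℝ), π (t - s) y ∂G := fun s hs =>
          setIntegral_nonneg measurableSet_Ioi fun y hy => hπ0 _ (sub_nonneg.2 hs.2) y hy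
        refine integral_mono_of_nonneg
          (ae_restrict_of_forall_mem measurableSet_Ioc fun s hs =>
            mul_nonneg (mul_nonneg (hα0 _) (hg0 _)) (hnn s hs))
          (Continuous.integrableOn_Ioc (by fun_prop))
          (ae_restrict_of_forall_mem measurableSet_Ioc fun s hs => ?_)
        have hts : 0 ≤ t - s := sub_nonneg.2 hs.2
        refine mul_le_mul (hαb' _) ?_ (hnn s hs) hb0
        exact setIntegral_le_of_forall_le G measurableSet_Ioi (by positivity)
          (fun y hy => hπ0 _ hts y hy)
          (fun y hy => ih (t - s) ⟨hts, by linarith [hs.1, ht.2]⟩ y hy)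
      rw [integral_exp_add_pow_div_factorial] at hint
      rw [hπeq t ht.1 x hx]
      linarith [hfF (x - t)]
  have hlim : Filter.Tendsto
      (fun n : ℕ => F * Real.exp (b * T) + C * ((b * T) ^ n / n.factorial)) Filter.atTop
      (nhds (F * Real.exp (b * T) + C * 0)) :=
    ((FloorSemiring.tendsto_pow_div_factorial_atTop (b * T)).const_mul C).const_add _
  rw [mul_zero, add_zero] at hlim
  exact ge_of_tendsto' hlim fun n => key n T ⟨hT, le_rfl⟩ x hx
end

section
/- Assume m2 := sup_{x>0} g''(x,1−) < ∞ and ∫_0^∞ x G(dx) < ∞. Let f be a bounded nonnegative Borel function on (0,∞), let (t,x) ↦ π_t(x) be the locally bounded nonnegative solution of π_t(x) = f(x−t) + ∫_0^t α(x−s) g'(x−s,1−) ⟨G, π_{t−s}⟩ ds, and set Π_t(x) = ∫_0^t π_s(x) ds. Assume Π_∞(x) := ∫_0^∞ π_s(x) ds < ∞ for all x > 0, with ⟨G, Π_∞⟩ < ∞ and ⟨G, Π_∞²⟩ < ∞. If (t,x) ↦ Γ_t(x) is a locally bounded nonnegative Borel solution of Γ_t(x) = ∫_0^t α(x−s)[g''(x−s,1−)·⟨G,Π_{t−s}⟩²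 + g'(x−s,1−)·⟨G,(Π_{t−s})²⟩] ds + ∫_0^t α(x−s) g'(x−s,1−) ⟨G,Γ_{t−s}⟩ ds, then for all t ≥ 0, ⟨G, Γ_t⟩ ≤ a3 e^{βt}, where β = sup_{x>0} α(x) g'(x,1−) and a3 = ‖α‖ (∫_0^∞ x G(dx)) [m2·⟨G,Π_∞⟩² + m·⟨G,Π_∞²⟩]. -/
open MeasureTheory Set

/-- `g''(x,1−) = Σ_{i≥2} i(i−1)·p(x,i)`. -/
noncomputable def gD2 (p : ℝ → ℕ → ℝ) (x : ℝ) : ℝ := ∑' i : ℕ, (i : ℝ) * ((i : ℝ) - 1) * p x i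

/-- Grönwall's inequality in integral form, for a locally bounded measurable function. -/
theorem le_mul_exp_of_le_add_integral {h : ℝ → ℝ} {a b : ℝ} (hm : Measurable h) (hb : 0 ≤ b)
    (hbd : ∀ T ≥ (0 : ℝ), ∃ C, ∀ t ∈ Icc (0 : ℝ) T, |h t| ≤ C)
    (hle : ∀ t ≥ (0 : ℝ), h t ≤ a + b * ∫ s in (0 : ℝ)..t, h s) :
    ∀ t ≥ (0 : ℝ), h t ≤ a * Real.exp (b * t) := by
  have hint : ∀ t ≥ (0 : ℝ), IntervalIntegrable h volume 0 t := by
    intro t ht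
    obtain ⟨C, hC⟩ := hbd t ht
    rw [intervalIntegrable_iff_integrableOn_Ioc_of_le ht]
    refine Measure.integrableOn_of_bounded (M := C) (by simp) hm.aestronglyMeasurable ?_
    filter_upwards [ae_restrict_mem measurableSet_Ioc] with s hs
    exact hC s ⟨hs.1.le, hs.2⟩
  have hexp : ∀ t : ℝ, IntervalIntegrable (fun s => a * Real.exp (b * s)) volume 0 t := fun t =>
    Continuous.intervalIntegrable (by fun_prop) _ _
  have hexpint : ∀ t : ℝ, b * ∫ s in (0 : ℝ)..t, a * Real.exp (b * s) =
      a * Real.exp (b * t) - a := by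
    intro t
    rw [← intervalIntegral.integral_const_mul]
    rw [intervalIntegral.integral_eq_sub_of_hasDerivAt (f := fun s => a * Real.exp (b * s))]
    · simp
    · intro s _
      have := ((hasDerivAt_const_mul (x := s) b).exp).const_mul a
      exact this.congr_deriv (by ring)
    · exact Continuous.intervalIntegrable (by fun_prop) _ _
  intro T hT
  obtain ⟨C, hC⟩ := hbd T hT
  set D := C + |a| * Real.exp (b * T) with hD
  have key : ∀ n : ℕ, ∀ t ∈ Icc (0 : ℝ) T,
      h t - a * Real.exp (b * t) ≤ D * ((b * t) ^ n / n.factorial) := by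
    intro n
    induction n with
    | zero =>
      intro t ht
      have h1 : h t ≤ C := (le_abs_self _).trans (hC t ht)
      have h2 : -(a * Real.exp (b * t)) ≤ |a| * Real.exp (b * T) := by
        calc -(a * Real.exp (b * t)) ≤ |a * Real.exp (b * t)| := neg_le_abs _
          _ = |a| * Real.exp (b * t) := by rw [abs_mul, Real.abs_exp]
          _ ≤ _ := by gcongr; exact ht.2
      simp only [pow_zero, Nat.factorial_zero, Nat.cast_one, div_one, mul_one]
      linarith
    | succ n ih =>
      intro t ht
      have hmono : ∫ s in (0 : ℝ)..t, (h s - a * Real.exp (b * s)) ≤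
          ∫ s in (0 : ℝ)..t, D * ((b * s) ^ n / n.factorial) := by
        refine intervalIntegral.integral_mono_on ht.1 ((hint t ht.1).sub (hexp t))
          (Continuous.intervalIntegrable (by fun_prop) _ _) ?_
        intro s hs
        exact ih s ⟨hs.1, hs.2.trans ht.2⟩
      have hval : b * ∫ s in (0 : ℝ)..t, D * ((b * s) ^ n / n.factorial) =
          D * ((b * t) ^ (n + 1) / (n + 1).factorial) := by
        have : (fun s : ℝ => D * ((b * s) ^ n / n.factorial)) =
            fun s => (D * b ^ n / n.factorial) * s ^ n := by
          funext s; rw [mul_pow]; ring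
        rw [this, intervalIntegral.integral_const_mul, integral_pow, Nat.factorial_succ]
        have h1 : (n.factorial : ℝ) ≠ 0 := by positivity
        have h2 : (n : ℝ) + 1 ≠ 0 := by positivity
        push_cast
        field_simp
        ring
      rw [intervalIntegral.integral_sub (hint t ht.1) (hexp t)] at hmono
      have h1 := mul_le_mul_of_nonneg_left hmono hb
      rw [mul_sub, hexpint, hval] at h1
      linarith [hle t ht.1]
  have hlim : Filter.Tendsto (fun n : ℕ => D * ((b * T) ^ n / n.factorial)) Filter.atTop
      (nhds (D * 0)) :=
    (FloorSemiring.tendsto_pow_div_factorial_atTop (b * T)).const_mul D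
  have := ge_of_tendsto' hlim (fun n => key n T ⟨hT, le_rfl⟩)
  linarith

theorem gD1_nonneg {p : ℝ → ℕ → ℝ} (hp0 : ∀ x i, 0 ≤ p x i) (x : ℝ) : 0 ≤ gD1 p x :=
  tsum_nonneg fun i => mul_nonneg i.cast_nonneg (hp0 x i)

theorem gD2_nonneg {p : ℝ → ℕ → ℝ} (hp0 : ∀ x i, 0 ≤ p x i) (x : ℝ) : 0 ≤ gD2 p x := by
  refine tsum_nonneg fun i => mul_nonneg ?_ (hp0 x i)
  rcases i with _ | i
  · simp
  · push_cast
    have : (0 : ℝ) ≤ i := i.cast_nonneg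
    nlinarith

/-- A function vanishing on `(-∞, 0]` and bounded by `c ≥ 0` has its translates' integrals
bounded by `c * x`, without any measurability assumption. -/
theorem integral_comp_sub_le_mul {φ : ℝ → ℝ} {c t x : ℝ} (hc : 0 ≤ c) (ht : 0 ≤ t) (hx : 0 < x)
    (h0 : ∀ s ∈ Ioc 0 t, 0 ≤ φ s) (hle : ∀ s ∈ Ioc 0 t, φ s ≤ c)
    (hz : ∀ s, x ≤ s → φ s = 0) :
    ∫ s in (0 : ℝ)..t, φ s ≤ c * x := by
  rw [intervalIntegral.integral_of_le ht]
  have hi : IntegrableOn ((Ioc 0 x).indicator fun _ => c) (Ioc 0 t) volume :=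
    (integrable_const c).indicator measurableSet_Ioc
  calc ∫ s in Ioc 0 t, φ s ≤ ∫ s in Ioc 0 t, (Ioc 0 x).indicator (fun _ => c) s := by
        refine integral_mono_of_nonneg ?_ hi ?_
        · filter_upwards [ae_restrict_mem measurableSet_Ioc] with s hs using h0 s hs
        · filter_upwards [ae_restrict_mem measurableSet_Ioc] with s hs
          by_cases hsx : s ≤ x
          · rw [indicator_of_mem (show s ∈ Ioc 0 x from ⟨hs.1, hsx⟩)]
            exact hle s hs
          · rw [hz s (not_le.1 hsx).le]
            exact indicator_nonneg (fun _ _ => hc) s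
    _ = ∫ s in Ioc 0 t ∩ Ioc 0 x, c := setIntegral_indicator measurableSet_Ioc
    _ ≤ ∫ s in Ioc 0 x, c := by
        refine setIntegral_mono_set (integrableOn_const (by simp)) ?_ ?_
        · exact Filter.Eventually.of_forall fun _ => hc
        · exact (inter_subset_right).eventuallyLE
    _ = c * x := by simp [hx.le, mul_comm]

theorem stmt_14
    (α : ℝ → ℝ) (hαm : Measurable α) (hα0 : ∀ x, 0 ≤ α x)
    (hαb : ∃ C, ∀ x, α x ≤ C) (hαz : ∀ x ≤ (0 : ℝ), α x = 0)
    (p : ℝ → ℕ → ℝ) (hp0 : ∀ x i, 0 ≤ p x i) (hp1 : ∀ x > (0 : ℝ), HasSum (p x) 1)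
    (hg1s : ∀ x > (0 : ℝ), Summable (fun i : ℕ => (i : ℝ) * p x i))
    (hg1b : ∃ m, ∀ x > (0 : ℝ), gD1 p x ≤ m)
    (hg2s : ∀ x > (0 : ℝ), Summable (fun i : ℕ => (i : ℝ) * ((i : ℝ) - 1) * p x i))
    (hg2b : ∃ m2, ∀ x > (0 : ℝ), gD2 p x ≤ m2)
    (G : Measure ℝ) [IsProbabilityMeasure G] (hGz : G (Iic 0) = 0)
    (hGmom : IntegrableOn (fun x : ℝ => x) (Ioi 0) G)
    (f : ℝ → ℝ) (hfm : Measurable f) (hf0 : ∀ x, 0 ≤ f x)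
    (hfb : ∃ C, ∀ x, f x ≤ C) (hfz : ∀ x ≤ (0 : ℝ), f x = 0)
    (π : ℝ → ℝ → ℝ) (hπm : Measurable (Function.uncurry π))
    (hπ0 : ∀ t ≥ (0 : ℝ), ∀ x > (0 : ℝ), 0 ≤ π t x)
    (hπb : ∀ T ≥ (0 : ℝ), ∃ C, ∀ t ∈ Icc (0 : ℝ) T, ∀ x > (0 : ℝ), |π t x| ≤ C)
    (hπeq : ∀ t ≥ (0 : ℝ), ∀ x > (0 : ℝ),
      π t x = f (x - t) + ∫ s in (0 : ℝ)..t, α (x - s) * gD1 p (x - s) *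
        (∫ y in Ioi (0 : ℝ), π (t - s) y ∂G))
    -- Π_∞(x) = ∫_0^∞ π_s(x) ds is finite, with ⟨G,Π_∞⟩ < ∞ and ⟨G,Π_∞²⟩ < ∞
    (hPifin : ∀ x > (0 : ℝ), IntegrableOn (fun s => π s x) (Ioi 0) volume)
    (hGPi : IntegrableOn (fun x => ∫ s in Ioi (0 : ℝ), π s x) (Ioi 0) G)
    (hGPi2 : IntegrableOn (fun x => (∫ s in Ioi (0 : ℝ), π s x) ^ 2) (Ioi 0) G)
    (Γ : ℝ → ℝ → ℝ) (hΓm : Measurable (Function.uncurry Γ))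
    (hΓ0 : ∀ t ≥ (0 : ℝ), ∀ x > (0 : ℝ), 0 ≤ Γ t x)
    (hΓb : ∀ T ≥ (0 : ℝ), ∃ C, ∀ t ∈ Icc (0 : ℝ) T, ∀ x > (0 : ℝ), |Γ t x| ≤ C)
    (hΓeq : ∀ t ≥ (0 : ℝ), ∀ x > (0 : ℝ),
      Γ t x =
        (∫ s in (0 : ℝ)..t, α (x - s) *
          (gD2 p (x - s) * (∫ y in Ioi (0 : ℝ), (∫ r in (0 : ℝ)..(t - s), π r y) ∂G) ^ 2 +
            gD1 p (x - s) * (∫ y in Ioi (0 : ℝ), (∫ r in (0 : ℝ)..(t - s), π r y) ^ 2 ∂G))) +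
          ∫ s in (0 : ℝ)..t, α (x - s) * gD1 p (x - s) *
            (∫ y in Ioi (0 : ℝ), Γ (t - s) y ∂G)) :
    ∀ t ≥ (0 : ℝ),
      (∫ x in Ioi (0 : ℝ), Γ t x ∂G) ≤
        (sSup (α '' Ioi 0) * (∫ x in Ioi (0 : ℝ), x ∂G) *
          (sSup (gD2 p '' Ioi 0) * (∫ y in Ioi (0 : ℝ), (∫ s in Ioi (0 : ℝ), π s y) ∂G) ^ 2 +
            sSup (gD1 p '' Ioi 0) * (∫ y in Ioi (0 : ℝ), (∫ s in Ioi (0 : ℝ), π s y) ^ 2 ∂G))) *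
          Real.exp (sSup ((fun y => α y * gD1 p y) '' Ioi 0) * t) := by
  set A := sSup (α '' Ioi 0) with hA
  set M1 := sSup (gD1 p '' Ioi 0) with hM1
  set M2 := sSup (gD2 p '' Ioi 0) with hM2
  set β := sSup ((fun y => α y * gD1 p y) '' Ioi 0) with hβ
  set P1 := ∫ y in Ioi (0 : ℝ), (∫ s in Ioi (0 : ℝ), π s y) ∂G with hP1
  set P2 := ∫ y in Ioi (0 : ℝ), (∫ s in Ioi (0 : ℝ), π s y) ^ 2 ∂G with hP2
  obtain ⟨Ca, hCa⟩ := hαb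
  obtain ⟨m1, hm1⟩ := hg1b
  obtain ⟨m2, hm2⟩ := hg2b
  have hg1 := gD1_nonneg hp0
  have hg2 := gD2_nonneg hp0
  have hAle : ∀ x > 0, α x ≤ A := fun x hx =>
    le_csSup ⟨Ca, by rintro _ ⟨y, -, rfl⟩; exact hCa y⟩ (mem_image_of_mem _ hx)
  have hM1le : ∀ x > 0, gD1 p x ≤ M1 := fun x hx =>
    le_csSup ⟨m1, by rintro _ ⟨y, hy, rfl⟩; exact hm1 y hy⟩ (mem_image_of_mem _ hx)
  have hM2le : ∀ x > 0, gD2 p x ≤ M2 := fun x hx =>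
    le_csSup ⟨m2, by rintro _ ⟨y, hy, rfl⟩; exact hm2 y hy⟩ (mem_image_of_mem _ hx)
  have hβle' : ∀ x > 0, α x * gD1 p x ≤ β := fun x hx =>
    le_csSup ⟨Ca * m1, by
      rintro _ ⟨y, hy, rfl⟩
      exact mul_le_mul (hCa y) (hm1 y hy) (hg1 y) ((hα0 y).trans (hCa y))⟩
      (mem_image_of_mem (fun y => α y * gD1 p y) hx)
  have hA0 : 0 ≤ A := (hα0 1).trans (hAle 1 one_pos)
  have hM10 : 0 ≤ M1 := (hg1 1).trans (hM1le 1 one_pos)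
  have hM20 : 0 ≤ M2 := (hg2 1).trans (hM2le 1 one_pos)
  have hβ0 : 0 ≤ β := (mul_nonneg (hα0 1) (hg1 1)).trans (hβle' 1 one_pos)
  have hβle : ∀ x, α x * gD1 p x ≤ β := by
    intro x
    rcases le_or_gt x 0 with hx | hx
    · simpa [hαz x hx] using hβ0
    · exact hβle' x hx
  have hP20 : 0 ≤ P2 := integral_nonneg fun _ => sq_nonneg _
  have hPi0 : ∀ t ≥ (0 : ℝ), ∀ y > (0 : ℝ), 0 ≤ ∫ r in (0 : ℝ)..t, π r y := fun t ht y hy =>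
    intervalIntegral.integral_nonneg ht fun s hs => hπ0 s hs.1 y hy
  have hPile : ∀ t ≥ (0 : ℝ), ∀ y > (0 : ℝ),
      ∫ r in (0 : ℝ)..t, π r y ≤ ∫ r in Ioi (0 : ℝ), π r y := by
    intro t ht y hy
    rw [intervalIntegral.integral_of_le ht]
    refine setIntegral_mono_set (hPifin y hy) ?_ Ioc_subset_Ioi_self.eventuallyLE
    filter_upwards [ae_restrict_mem measurableSet_Ioi] with s hs using hπ0 s (le_of_lt hs) y hy
  have hQ1n : ∀ t ≥ (0 : ℝ), 0 ≤ ∫ y in Ioi (0 : ℝ), (∫ r in (0 : ℝ)..t, π r y) ∂G :=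
    fun t ht => setIntegral_nonneg measurableSet_Ioi fun y hy => hPi0 t ht y hy
  have hQ1 : ∀ t ≥ (0 : ℝ), ∫ y in Ioi (0 : ℝ), (∫ r in (0 : ℝ)..t, π r y) ∂G ≤ P1 := by
    intro t ht
    refine integral_mono_of_nonneg ?_ hGPi ?_
    · filter_upwards [ae_restrict_mem measurableSet_Ioi] with y hy using hPi0 t ht y hy
    · filter_upwards [ae_restrict_mem measurableSet_Ioi] with y hy using hPile t ht y hy
  have hQ2n : ∀ t : ℝ, 0 ≤ ∫ y in Ioi (0 : ℝ), (∫ r in (0 : ℝ)..t, π r y) ^ 2 ∂G :=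
    fun t => integral_nonneg fun _ => sq_nonneg _
  have hQ2 : ∀ t ≥ (0 : ℝ), ∫ y in Ioi (0 : ℝ), (∫ r in (0 : ℝ)..t, π r y) ^ 2 ∂G ≤ P2 := by
    intro t ht
    refine integral_mono_of_nonneg (Filter.Eventually.of_forall fun _ => sq_nonneg _) hGPi2 ?_
    filter_upwards [ae_restrict_mem measurableSet_Ioi] with y hy
    exact pow_le_pow_left₀ (hPi0 t ht y hy) (hPile t ht y hy) 2
  set K := M2 * P1 ^ 2 + M1 * P2 with hK
  have hK0 : 0 ≤ K := by positivity
  set h : ℝ → ℝ := fun t => ∫ y in Ioi (0 : ℝ), Γ t y ∂G with hh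
  have hhm : Measurable h :=
    (hΓm.stronglyMeasurable.integral_prod_right (ν := G.restrict (Ioi 0))).measurable
  have hh0 : ∀ t ≥ (0 : ℝ), 0 ≤ h t := fun t ht =>
    setIntegral_nonneg measurableSet_Ioi fun y hy => hΓ0 t ht y hy
  have hhb : ∀ T ≥ (0 : ℝ), ∃ C, ∀ t ∈ Icc (0 : ℝ) T, |h t| ≤ C := by
    intro T hT
    obtain ⟨C, hC⟩ := hΓb T hT
    refine ⟨C * G.real (Ioi 0), fun t ht => ?_⟩
    rw [← Real.norm_eq_abs]
    exact norm_setIntegral_le_of_norm_le_const (measure_lt_top _ _) fun y hy => hC t ht y hy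
  have hhint : ∀ t ≥ (0 : ℝ), IntervalIntegrable h volume 0 t := by
    intro t ht
    obtain ⟨C, hC⟩ := hhb t ht
    rw [intervalIntegrable_iff_integrableOn_Ioc_of_le ht]
    refine Measure.integrableOn_of_bounded (M := C) (by simp) hhm.aestronglyMeasurable ?_
    filter_upwards [ae_restrict_mem measurableSet_Ioc] with s hs
    exact hC s ⟨hs.1.le, hs.2⟩
  have hΓle : ∀ t ≥ (0 : ℝ), ∀ x > (0 : ℝ),
      Γ t x ≤ A * K * x + β * ∫ s in (0 : ℝ)..t, h s := by
    intro t ht x hx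
    rw [hΓeq t ht x hx]
    refine add_le_add ?_ ?_
    · refine integral_comp_sub_le_mul (mul_nonneg hA0 hK0) ht hx ?_ ?_ ?_
      · intro s hs
        exact mul_nonneg (hα0 _) (add_nonneg (mul_nonneg (hg2 _) (sq_nonneg _))
          (mul_nonneg (hg1 _) (hQ2n _)))
      · intro s hs
        have hts : 0 ≤ t - s := sub_nonneg.2 hs.2
        rcases le_or_gt (x - s) 0 with hxs | hxs
        · rw [hαz _ hxs, zero_mul]
          exact mul_nonneg hA0 hK0
        · refine mul_le_mul (hAle _ hxs) ?_ ?_ hA0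
          · refine add_le_add ?_ ?_
            · exact mul_le_mul (hM2le _ hxs) (pow_le_pow_left₀ (hQ1n _ hts) (hQ1 _ hts) 2)
                (sq_nonneg _) hM20
            · exact mul_le_mul (hM1le _ hxs) (hQ2 _ hts) (hQ2n _) hM10
          · exact add_nonneg (mul_nonneg (hg2 _) (sq_nonneg _)) (mul_nonneg (hg1 _) (hQ2n _))
      · intro s hs
        rw [hαz _ (sub_nonpos.2 hs), zero_mul]
    · have hsub : ∫ s in (0 : ℝ)..t, h (t - s) = ∫ s in (0 : ℝ)..t, h s := by
        simp [intervalIntegral.integral_comp_sub_left (fun s => h s) t]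
      have hi : IntervalIntegrable (fun s => β * h (t - s)) volume 0 t := by
        have := ((hhint t ht).comp_sub_left t).const_mul β
        simpa using this.symm
      rw [← hsub, ← intervalIntegral.integral_const_mul, intervalIntegral.integral_of_le ht,
        intervalIntegral.integral_of_le ht]
      refine integral_mono_of_nonneg ?_
        ((intervalIntegrable_iff_integrableOn_Ioc_of_le ht).1 hi) ?_
      · filter_upwards [ae_restrict_mem measurableSet_Ioc] with s hs
        exact mul_nonneg (mul_nonneg (hα0 _) (hg1 _)) (hh0 _ (sub_nonneg.2 hs.2))
      · filter_upwards [ae_restrict_mem measurableSet_Ioc] with s hs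
        exact mul_le_mul_of_nonneg_right (hβle _) (hh0 _ (sub_nonneg.2 hs.2))
  have hG1 : G.real (Ioi 0) = 1 := by
    rw [← compl_Iic, probReal_compl_eq_one_sub measurableSet_Iic]
    simp [Measure.real, hGz]
  refine le_mul_exp_of_le_add_integral (h := h) hhm hβ0 hhb fun t ht => ?_
  have hi1 : IntegrableOn (fun x : ℝ => A * K * x) (Ioi 0) G := hGmom.const_mul _
  have hi2 : IntegrableOn (fun _ : ℝ => β * ∫ s in (0 : ℝ)..t, h s) (Ioi 0) G :=
    integrableOn_const (measure_ne_top _ _)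
  calc h t ≤ ∫ x in Ioi (0 : ℝ), (A * K * x + β * ∫ s in (0 : ℝ)..t, h s) ∂G := by
        refine integral_mono_of_nonneg ?_ (hi1.add hi2) ?_
        · filter_upwards [ae_restrict_mem measurableSet_Ioi] with x hx using hΓ0 t ht x hx
        · filter_upwards [ae_restrict_mem measurableSet_Ioi] with x hx using hΓle t ht x hx
    _ = A * K * (∫ x in Ioi (0 : ℝ), x ∂G) + β * ∫ s in (0 : ℝ)..t, h s := by
        rw [integral_add hi1 hi2, integral_const_mul, setIntegral_const, hG1, one_smul]
    _ = _ := by ring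
end

section
/- Let α : (0,∞) → [0,∞) be a bounded Borel function and f a bounded nonnegative Borel function on (0,∞), both extended by 0 to (−∞,0]. Then the function Ũ_t(x) = (1 − e^{−f(x−t)}) exp{ −∫_0^t α(x−s) ds } is the unique locally bounded solution of the linear Volterra equation Ũ_t(x) = 1 − e^{−f(x−t)} − ∫_0^t α(x−s) Ũ_{t−s}(x−s) ds for t ≥ 0 and x > 0; that is, Ũ satisfies this equation, and any locally bounded Borel function on [0,∞) × (0,∞) satisfying it coincides with Ũ. -/
open MeasureTheory Set

open scoped NNReal in
theorem LipschitzOnWith.comp_absolutelyContinuousOnInterval {g f : ℝ → ℝ} {K : ℝ≥0} {a b : ℝ}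
    {s : Set ℝ} (hg : LipschitzOnWith K g s) (hf : AbsolutelyContinuousOnInterval f a b)
    (hs : MapsTo f (uIcc a b) s) : AbsolutelyContinuousOnInterval (fun x ↦ g (f x)) a b := by
  rw [absolutelyContinuousOnInterval_iff] at hf ⊢
  intro ε hε
  obtain ⟨δ, hδ, H⟩ := hf (ε / (K + 1)) (by positivity)
  refine ⟨δ, hδ, fun E hE hlen ↦ ?_⟩
  calc ∑ i ∈ Finset.range E.1, dist (g (f (E.2 i).1)) (g (f (E.2 i).2))
      ≤ ∑ i ∈ Finset.range E.1, K * dist (f (E.2 i).1) (f (E.2 i).2) :=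
        Finset.sum_le_sum fun i hi ↦
          hg.dist_le_mul _ (hs (hE.1 i hi).1) _ (hs (hE.1 i hi).2)
    _ = K * ∑ i ∈ Finset.range E.1, dist (f (E.2 i).1) (f (E.2 i).2) := by rw [Finset.mul_sum]
    _ ≤ K * (ε / (K + 1)) := by gcongr; exact (H E hE hlen).le
    _ < ε := by
        rw [mul_div_assoc', div_lt_iff₀ (by positivity)]
        nlinarith

theorem AbsolutelyContinuousOnInterval.exp {f : ℝ → ℝ} {a b : ℝ}
    (hf : AbsolutelyContinuousOnInterval f a b) :
    AbsolutelyContinuousOnInterval (fun x ↦ Real.exp (f x)) a b := by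
  obtain ⟨C, hC⟩ := hf.exists_bound
  obtain ⟨K, hK⟩ := (Real.contDiff_exp (n := 1)).contDiffOn.exists_lipschitzOnWith
    (s := Metric.closedBall (0 : ℝ) C) (by simp) (convex_closedBall _ _)
    (isCompact_closedBall _ _)
  exact hK.comp_absolutelyContinuousOnInterval hf fun x hx ↦ by simpa using hC x hx

theorem IntervalIntegrable.integral_mul_exp_neg_integral {α : ℝ → ℝ} {a b : ℝ}
    (hα : IntervalIntegrable α volume a b) :
    ∫ u in a..b, α u * Real.exp (-∫ r in a..u, α r) = 1 - Real.exp (-∫ r in a..b, α r) := by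
  have hac := (hα.absolutelyContinuousOnInterval_intervalIntegral left_mem_uIcc).fun_neg.exp.fun_neg
  have := hac.integral_deriv_eq_sub
  simp only [intervalIntegral.integral_same, neg_zero, Real.exp_zero] at this
  rw [show (1 : ℝ) - Real.exp (-∫ r in a..b, α r) = -Real.exp (-∫ r in a..b, α r) - -1 by ring,
    ← this]
  apply intervalIntegral.integral_congr_ae
  filter_upwards [hα.ae_hasDerivAt_integral] with u hu hmem
  rw [(hu (uIoc_subset_uIcc hmem) a left_mem_uIcc).fun_neg.exp.fun_neg.deriv]
  ring

/-- Solution formula for the scalar Carathéodory equation `F' = -α F`, `F a = c`. -/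
theorem eq_mul_exp_neg_integral_of_integral_eq {α h : ℝ → ℝ} {a b c : ℝ}
    (hα : IntervalIntegrable α volume a b) (hh : IntervalIntegrable h volume a b)
    (heq : ∀ y ∈ uIcc a b, h y = α y * (c - ∫ u in a..y, h u)) :
    c - ∫ u in a..b, h u = c * Real.exp (-∫ u in a..b, α u) := by
  have hA := (hα.absolutelyContinuousOnInterval_intervalIntegral left_mem_uIcc).exp
  have hc : AbsolutelyContinuousOnInterval (fun _ : ℝ ↦ c) a b :=
    contDiffOn_const.absolutelyContinuousOnInterval
  have hF := hc.fun_sub (hh.absolutelyContinuousOnInterval_intervalIntegral left_mem_uIcc)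
  obtain ⟨C, hC⟩ := (hF.fun_mul hA).const_of_ae_hasDerivAt_zero <| by
    filter_upwards [hα.ae_hasDerivAt_integral, hh.ae_hasDerivAt_integral] with y hαy hhy hy
    refine (((hhy hy a left_mem_uIcc).const_sub c).fun_mul
      (hαy hy a left_mem_uIcc).exp).congr_deriv ?_
    rw [heq y hy]
    ring
  have ha := hC a left_mem_uIcc
  have hb := hC b right_mem_uIcc
  simp only [intervalIntegral.integral_same, Real.exp_zero, sub_zero, mul_one] at ha
  rw [Real.exp_neg, ← div_eq_mul_inv, eq_div_iff (Real.exp_pos _).ne', hb, ha]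

theorem Measurable.intervalIntegrable_of_bound {g : ℝ → ℝ} (hg : Measurable g) {a b C : ℝ}
    (hC : ∀ u ∈ uIoc a b, ‖g u‖ ≤ C) : IntervalIntegrable g volume a b :=
  (intervalIntegrable_const (c := C)).mono_fun' hg.aestronglyMeasurable <|
    (ae_restrict_iff' measurableSet_uIoc).2 (.of_forall hC)

theorem stmt_17
    (α : ℝ → ℝ) (hαm : Measurable α) (hα0 : ∀ x, 0 ≤ α x)
    (hαb : ∃ C, ∀ x, α x ≤ C) (hαz : ∀ x ≤ (0 : ℝ), α x = 0)
    (f : ℝ → ℝ) (hfm : Measurable f) (hf0 : ∀ x, 0 ≤ f x)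
    (hfb : ∃ C, ∀ x, f x ≤ C) (hfz : ∀ x ≤ (0 : ℝ), f x = 0) :
    -- Ũ_t(x) = (1 − e^{−f(x−t)}) exp{−∫_0^t α(x−s) ds} satisfies the equation
    (∀ t ≥ (0 : ℝ), ∀ x > (0 : ℝ),
      (1 - Real.exp (-(f (x - t)))) * Real.exp (-(∫ s in (0 : ℝ)..t, α (x - s))) =
        1 - Real.exp (-(f (x - t))) -
          ∫ s in (0 : ℝ)..t, α (x - s) *
            ((1 - Real.exp (-(f (x - s - (t - s))))) *
              Real.exp (-(∫ r in (0 : ℝ)..(t - s), α (x - s - r))))) ∧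
    -- and any locally bounded Borel solution coincides with it
    (∀ W : ℝ → ℝ → ℝ, Measurable (Function.uncurry W) →
      (∀ T ≥ (0 : ℝ), ∃ C, ∀ t ∈ Icc (0 : ℝ) T, ∀ x > (0 : ℝ), |W t x| ≤ C) →
      (∀ t ≥ (0 : ℝ), ∀ x > (0 : ℝ),
        W t x = 1 - Real.exp (-(f (x - t))) -
          ∫ s in (0 : ℝ)..t, α (x - s) * W (t - s) (x - s)) →
      ∀ t ≥ (0 : ℝ), ∀ x > (0 : ℝ),
        W t x = (1 - Real.exp (-(f (x - t)))) *
          Real.exp (-(∫ s in (0 : ℝ)..t, α (x - s)))) := by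
  obtain ⟨M, hM⟩ := hαb
  have hα (a b : ℝ) : IntervalIntegrable α volume a b :=
    hαm.intervalIntegrable_of_bound (C := M) fun u _ ↦ by
      rw [Real.norm_of_nonneg (hα0 u)]; exact hM u
  refine ⟨fun t _ x _ ↦ ?_, fun W hWm hWb hW t ht x hx ↦ ?_⟩
  · have hinner (s : ℝ) :
        ∫ r in (0 : ℝ)..(t - s), α (x - s - r) = ∫ r in (x - t)..(x - s), α r := by
      rw [intervalIntegral.integral_comp_sub_left (fun r ↦ α r)]
      congr 1 <;> ring
    have houter := intervalIntegral.integral_comp_sub_left (a := 0) (b := t)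
      (fun u ↦ α u * ((1 - Real.exp (-(f (x - t)))) * Real.exp (-∫ r in (x - t)..u, α r))) x
    have hdiff (s : ℝ) : x - s - (t - s) = x - t := by ring
    simp only [hinner, hdiff]
    rw [houter, intervalIntegral.integral_comp_sub_left (fun r ↦ α r), sub_zero]
    simp only [mul_left_comm (α _)]
    rw [intervalIntegral.integral_const_mul, (hα _ _).integral_mul_exp_neg_integral]
    ring
  · set a := x - t with ha
    have hax : a ≤ x := by linarith
    set h : ℝ → ℝ := fun u ↦ α u * W (u - a) u with h_def
    obtain ⟨C, hC⟩ := hWb t ht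
    have hh : IntervalIntegrable h volume a x := by
      have hm : Measurable h :=
        hαm.mul (hWm.comp ((measurable_id.sub_const a).prodMk measurable_id))
      refine hm.intervalIntegrable_of_bound (C := M * |C|) fun u hu ↦ ?_
      rw [uIoc_of_le hax] at hu
      have hM0 : 0 ≤ M := (hα0 0).trans (hM 0)
      rcases le_or_gt u 0 with hu0 | hu0
      · simp only [h_def, hαz u hu0, zero_mul, norm_zero]
        positivity
      · rw [h_def, norm_mul, Real.norm_of_nonneg (hα0 u)]
        have := hC (u - a) ⟨by linarith [hu.1], by linarith [hu.2]⟩ u hu0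
        exact mul_le_mul (hM u) (this.trans (le_abs_self C)) (norm_nonneg _) hM0
    have hchar (y : ℝ) (hay : a ≤ y) (hy : 0 < y) :
        W (y - a) y = 1 - Real.exp (-(f a)) - ∫ u in a..y, h u := by
      have hsub := intervalIntegral.integral_comp_sub_left (a := 0) (b := y - a) h y
      rw [sub_sub_cancel, sub_zero] at hsub
      rw [hW (y - a) (sub_nonneg.2 hay) y hy, ← hsub, sub_sub_cancel]
      simp only [h_def, sub_right_comm y a]
    have hsol := eq_mul_exp_neg_integral_of_integral_eq (c := 1 - Real.exp (-(f a)))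
      (hα a x) hh fun y hy ↦ by
        rw [uIcc_of_le hax] at hy
        rcases le_or_gt y 0 with hy0 | hy0
        · simp [h_def, hαz y hy0]
        · rw [← hchar y hy.1 hy0]
    rw [← hchar x hax hx, ha, sub_sub_cancel] at hsol
    rw [hsol, intervalIntegral.integral_comp_sub_left (fun r ↦ α r), sub_zero]
end
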